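/- arXiv:2307.10510 — 3 statements merged into one kernel-verified Lean document; each statement's English description precedes it below -/
import Mathlib

section
/- Let k ≥ 5 be odd and r = k + ⌊k/2⌋ − 2, and consider a red/blue coloring of the complete graph K_r of the following form (a Type 2a coloring): the vertex set is partitioned into A and B with |A| = ⌊k/2⌋ − 1 and |B| = k − 1, one distinguished edge b inside B is red, every other edge inside B is blue, every edge between A and B is red, and edges inside A are colored arbitrarily. Then: (1) every vertex of B is a strict endpoint of a blue P_{k−1}; (2) every vertex of B is a strict endpoint of a red P_{k−1}; (3) every vertex of A is a strict endpoint of a red P_{k−2}. -/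
/-- `G` contains a path on `n` vertices (as a subgraph). -/
def HasNPath {V : Type*} (G : SimpleGraph V) (n : ℕ) : Prop :=
  ∃ (u w : V) (p : G.Walk u w), p.IsPath ∧ p.length + 1 = n

/-- `v` is an endpoint of a path on `n` vertices in `G`. -/
def IsPathEndpoint {V : Type*} (G : SimpleGraph V) (v : V) (n : ℕ) : Prop :=
  ∃ (w : V) (p : G.Walk v w), p.IsPath ∧ p.length + 1 = n

/-- `x` is the maximum number of vertices of a path in `G` having `v` as an endpoint;
we then say `v` is a strict endpoint of a `P_x` in `G`. -/
def StrictEndpoint {V : Type*} (G : SimpleGraph V) (v : V) (x : ℕ) : Prop :=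
  IsPathEndpoint G v x ∧ ∀ y, IsPathEndpoint G v y → y ≤ x

/-- A red/blue coloring of the edges of `G` is given by its red subgraph `R ≤ G`;
the blue subgraph is `G \ R`.  The coloring is `(P_k, P_ℓ)`-good if the red subgraph
has no path on `k` vertices and the blue subgraph has no path on `ℓ` vertices. -/
def GoodColoring {V : Type*} (G R : SimpleGraph V) (k ℓ : ℕ) : Prop :=
  R ≤ G ∧ ¬ HasNPath R k ∧ ¬ HasNPath (G \ R) ℓ

/-- `G` is `(P_k, P_ℓ)`-good if it admits at least one `(P_k, P_ℓ)`-good coloring. -/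
def IsGood {V : Type*} (G : SimpleGraph V) (k ℓ : ℕ) : Prop :=
  ∃ R : SimpleGraph V, GoodColoring G R k ℓ

section PathIn

variable {V : Type*} {G : SimpleGraph V}

/-- `v` is an endpoint of a path of `G` on `n` vertices, all of which lie in `S`. -/
def IsPathEndpointIn (G : SimpleGraph V) (S : Finset V) (v : V) (n : ℕ) : Prop :=
  ∃ (w : V) (p : G.Walk v w), p.IsPath ∧ p.length + 1 = n ∧ ∀ x ∈ p.support, x ∈ S

lemma IsPathEndpointIn.isPathEndpoint {S : Finset V} {v : V} {n : ℕ}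
    (h : IsPathEndpointIn G S v n) : IsPathEndpoint G v n := by
  obtain ⟨w, p, hp, hl, -⟩ := h
  exact ⟨w, p, hp, hl⟩

lemma IsPathEndpointIn.mono {S T : Finset V} {v : V} {n : ℕ}
    (h : IsPathEndpointIn G S v n) (hST : S ⊆ T) : IsPathEndpointIn G T v n := by
  obtain ⟨w, p, hp, hl, hS⟩ := h
  exact ⟨w, p, hp, hl, fun x hx => hST (hS x hx)⟩

lemma isPathEndpointIn_one {S : Finset V} {v : V} (hv : v ∈ S) : IsPathEndpointIn G S v 1 :=
  ⟨v, .nil, by simp, by simp, by simpa using hv⟩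

lemma SimpleGraph.Walk.forall_mem_support_of_closed {s : Set V}
    (hs : ∀ x ∈ s, ∀ y, G.Adj x y → y ∈ s) {v w : V} (p : G.Walk v w) (hv : v ∈ s) :
    ∀ x ∈ p.support, x ∈ s := by
  induction p with
  | nil => simpa using hv
  | cons h p ih =>
    simp only [SimpleGraph.Walk.support_cons, List.mem_cons, forall_eq_or_imp]
    exact ⟨hv, ih (hs _ hv _ h)⟩

variable [DecidableEq V]

lemma IsPathEndpointIn.cons {S : Finset V} {u v : V} {n : ℕ}
    (h : IsPathEndpointIn G (S.erase u) v n) (huv : G.Adj u v) (hu : u ∈ S) :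
    IsPathEndpointIn G S u (n + 1) := by
  obtain ⟨w, p, hp, hl, hS⟩ := h
  refine ⟨w, .cons huv p, ?_, by simp [hl], ?_⟩
  · rw [SimpleGraph.Walk.cons_isPath_iff]
    exact ⟨hp, fun hmem => Finset.notMem_erase u S (hS u hmem)⟩
  · intro x hx
    rw [SimpleGraph.Walk.support_cons, List.mem_cons] at hx
    rcases hx with rfl | hx
    · exact hu
    · exact Finset.mem_of_mem_erase (hS x hx)

lemma isPathEndpointIn_card_of_isClique (S : Finset V) (hS : G.IsClique S) {v : V} (hv : v ∈ S) :
    IsPathEndpointIn G S v S.card := by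
  induction S using Finset.strongInduction generalizing v with
  | H S ih =>
    rcases (S.erase v).eq_empty_or_nonempty with h | ⟨w, hw⟩
    · have hcard : S.card = 1 := by
        rw [← Finset.card_erase_add_one hv, h, Finset.card_empty]
      rw [hcard]
      exact isPathEndpointIn_one hv
    · have := ih (S.erase v) (Finset.erase_ssubset hv)
        (hS.subset (by simp)) hw
      rw [← Finset.card_erase_add_one hv]
      exact this.cons (hS hv (Finset.mem_of_mem_erase hw) (Finset.ne_of_mem_erase hw).symm) hv

/-- In a complete bipartite graph whose part `Y` exceeds `X`, each vertex of `Y` starts an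
alternating path that exhausts `X`. -/
lemma isPathEndpointIn_of_bipartite (X Y : Finset V) (hXY : Disjoint X Y)
    (hadj : ∀ x ∈ X, ∀ y ∈ Y, G.Adj x y) (hcard : X.card + 1 ≤ Y.card) {v : V} (hv : v ∈ Y) :
    IsPathEndpointIn G (X ∪ Y) v (2 * X.card + 1) := by
  induction X using Finset.strongInduction generalizing Y v with
  | H X ih =>
    rcases X.eq_empty_or_nonempty with rfl | ⟨a, ha⟩
    · simpa using isPathEndpointIn_one hv
    · have hY := Finset.card_erase_add_one hv
      have hX := Finset.card_erase_add_one ha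
      obtain ⟨w, hw⟩ : (Y.erase v).Nonempty := by
        rw [← Finset.card_pos]; omega
      have hav : a ≠ v := fun h => Finset.disjoint_left.mp hXY ha (h ▸ hv)
      have hrec := ih (X.erase a) (Finset.erase_ssubset ha) (Y.erase v)
        (hXY.mono (Finset.erase_subset _ _) (Finset.erase_subset _ _))
        (fun x hx y hy => hadj x (Finset.mem_of_mem_erase hx) y (Finset.mem_of_mem_erase hy))
        (by omega) hw
      have hmono := hrec.mono (T := ((X ∪ Y).erase v).erase a) (by
        intro x hx
        have h1 : x ∈ X → x ∉ Y := fun h => Finset.disjoint_left.mp hXY h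
        have h2 := Finset.disjoint_left.mp hXY ha
        grind)
      have := (hmono.cons (hadj a ha w (Finset.mem_of_mem_erase hw)) (by simp [ha, hav])).cons
        (hadj a ha v hv).symm (by simp [hv])
      rwa [show 2 * X.card + 1 = 2 * (X.erase a).card + 1 + 1 + 1 by omega]

/-- A graph on `B` missing only the edge `s(b₁, b₂)` has a Hamiltonian path from every vertex
once `B` has at least four elements. -/
lemma isPathEndpointIn_card_of_adj_of_ne {B : Finset V} {b₁ b₂ v : V} (hb₁ : b₁ ∈ B)
    (hb₂ : b₂ ∈ B) (hne : b₁ ≠ b₂) (hB : 4 ≤ B.card)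
    (hadj : ∀ x ∈ B, ∀ y ∈ B, x ≠ y → s(x, y) ≠ s(b₁, b₂) → G.Adj x y) (hv : v ∈ B) :
    IsPathEndpointIn G B v B.card := by
  obtain ⟨x, hx⟩ : (((B.erase b₁).erase b₂).erase v).Nonempty := by
    rw [← Finset.card_pos]
    have h1 := Finset.pred_card_le_card_erase (s := B) (a := b₁)
    have h2 := Finset.pred_card_le_card_erase (s := B.erase b₁) (a := b₂)
    have h3 := Finset.pred_card_le_card_erase (s := (B.erase b₁).erase b₂) (a := v)
    omega
  simp only [Finset.mem_erase] at hx
  obtain ⟨hxv, hx2, hx1, hxB⟩ := hx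
  have end_case : ∀ c d, s(c, d) = s(b₁, b₂) → c ∈ B → x ≠ c → x ≠ d →
      IsPathEndpointIn G B c B.card := by
    intro c d hcd hc hxc hxd
    have hcl : G.IsClique (B.erase c : Finset V) := by
      intro y hy z hz hyz
      simp only [Finset.coe_erase, Set.mem_sdiff, Finset.mem_coe, Set.mem_singleton_iff] at hy hz
      refine hadj y hy.1 z hz.1 hyz ?_
      rw [← hcd]
      simp [hy.2, hz.2]
    have := (isPathEndpointIn_card_of_isClique (B.erase c) hcl
      (Finset.mem_erase.mpr ⟨hxc, hxB⟩)).cons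
      (hadj c hc x hxB hxc.symm (by rw [← hcd]; simp [hxd, hxc])) hc
    rwa [Finset.card_erase_add_one hc] at this
  by_cases h1 : v = b₁
  · subst h1; exact end_case v b₂ rfl hv hxv hx2
  by_cases h2 : v = b₂
  · subst h2; exact end_case v b₁ Sym2.eq_swap hv hxv hx1
  have hb₁' : b₁ ∈ B.erase v := Finset.mem_erase.mpr ⟨Ne.symm h1, hb₁⟩
  have hcl : G.IsClique ((B.erase v).erase b₁ : Finset V) := by
    intro y hy z hz hyz
    simp only [Finset.mem_coe, Finset.mem_erase] at hy hz
    refine hadj y hy.2.2 z hz.2.2 hyz ?_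
    simp [hy.1, hz.1]
  have := ((isPathEndpointIn_card_of_isClique _ hcl (v := x) (by simp [hxv, hx1, hxB])).cons
    (hadj b₁ hb₁ x hxB hx1.symm (by simp [hx1, hx2])) hb₁').cons
    (hadj v hv b₁ hb₁ h1 (by simp [h1, h2])) hv
  rwa [Finset.card_erase_add_one hb₁', Finset.card_erase_add_one hv] at this

lemma List.Nodup.countP_mem_le_card {l : List V} (hl : l.Nodup) (S : Finset V) :
    l.countP (· ∈ S) ≤ S.card := by
  rw [List.countP_eq_length_filter, ← List.toFinset_card_of_nodup (hl.filter _)]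
  refine Finset.card_le_card fun x hx => ?_
  simpa using (List.mem_filter.mp (List.mem_toFinset.mp hx)).2

/-- If `e` is the only edge with no end in `A`, then a walk visits the complement of `A` at most
as often as it visits `A` or traverses `e`, plus one if it starts outside `A`. -/
lemma SimpleGraph.Walk.countP_notMem_support_le {A : Finset V} {e : Sym2 V}
    (hA : ∀ x y, x ∉ A → y ∉ A → G.Adj x y → s(x, y) = e) {v w : V} (p : G.Walk v w) :
    p.support.countP (· ∉ A) ≤
      p.support.countP (· ∈ A) + p.edges.count e + if v ∈ A then 0 else 1 := by
  induction p with
  | @nil u => by_cases hu : u ∈ A <;> simp [hu]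
  | @cons u v w h p ih =>
    by_cases hu : u ∈ A
    · have hle : (if v ∈ A then 0 else 1) ≤ 1 := by split_ifs <;> simp
      simp [hu, List.count_cons] at ih ⊢
      omega
    · by_cases hv : v ∈ A
      · simp [hu, hv, List.count_cons] at ih ⊢
        omega
      · simp [hu, hv, hA u v hu hv h] at ih ⊢
        omega

lemma SimpleGraph.Walk.IsPath.length_add_one_le {A : Finset V} {e : Sym2 V}
    (hA : ∀ x y, x ∉ A → y ∉ A → G.Adj x y → s(x, y) = e) {v w : V} {p : G.Walk v w}
    (hp : p.IsPath) : p.length + 1 ≤ 2 * A.card + 1 + if v ∈ A then 0 else 1 := by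
  have h1 := p.countP_notMem_support_le hA
  have h2 := hp.support_nodup.countP_mem_le_card A
  have h3 : p.edges.count e ≤ 1 := List.nodup_iff_count_le_one.mp hp.isTrail.edges_nodup e
  have h4 := List.length_eq_countP_add_countP (· ∈ A) (l := p.support)
  rw [SimpleGraph.Walk.length_support] at h4
  simp only [decide_eq_true_eq] at h4
  omega

end PathIn

/-- properties of Type 2a (P_k, P_k)-good colorings of K_r,
r = k + ⌊k/2⌋ − 2, for odd k ≥ 5.  The red subgraph is R; the distinguished red
edge inside B is (b₁, b₂). -/
theorem stmt15 (k : ℕ) (hodd : Odd k) (hk : 5 ≤ k)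
    (A B : Finset (Fin (k + k / 2 - 2)))
    (hpart : A ∪ B = Finset.univ) (hdisj : Disjoint A B)
    (hA : A.card = k / 2 - 1) (hB : B.card = k - 1)
    (b₁ b₂ : Fin (k + k / 2 - 2)) (hb₁ : b₁ ∈ B) (hb₂ : b₂ ∈ B) (hbne : b₁ ≠ b₂)
    (R : SimpleGraph (Fin (k + k / 2 - 2)))
    (hAB : ∀ a ∈ A, ∀ b ∈ B, R.Adj a b)
    (hBB : ∀ x ∈ B, ∀ y ∈ B,
      (R.Adj x y ↔ (x = b₁ ∧ y = b₂) ∨ (x = b₂ ∧ y = b₁))) :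
    (∀ b ∈ B, StrictEndpoint (⊤ \ R) b (k - 1)) ∧
    (∀ b ∈ B, StrictEndpoint R b (k - 1)) ∧
    (∀ a ∈ A, StrictEndpoint R a (k - 2)) := by
  have hk2 : k = 2 * (k / 2) + 1 := by obtain ⟨j, rfl⟩ := hodd; omega
  have hnA : ∀ x, x ∉ A ↔ x ∈ B := fun x => by
    have h1 : x ∈ A ∪ B := hpart ▸ Finset.mem_univ x
    have h2 : x ∈ A → x ∉ B := fun h => Finset.disjoint_left.mp hdisj h
    grind
  have hedge : ∀ x y, x ∉ A → y ∉ A → R.Adj x y → s(x, y) = s(b₁, b₂) := by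
    intro x y hx hy h
    simpa using (hBB x ((hnA x).mp hx) y ((hnA y).mp hy)).mp h
  have hred : R.Adj b₁ b₂ := (hBB b₁ hb₁ b₂ hb₂).mpr (.inl ⟨rfl, rfl⟩)
  have alternating : ∀ X ⊆ A, ∀ Y ⊆ B, X.card + 1 ≤ Y.card → ∀ v ∈ Y,
      IsPathEndpointIn R (X ∪ Y) v (2 * X.card + 1) := fun X hX Y hY hcard v hv =>
    isPathEndpointIn_of_bipartite X Y (hdisj.mono hX hY)
      (fun x hx y hy => hAB x (hX hx) y (hY hy)) hcard hv
  refine ⟨fun b hb => ⟨?_, ?_⟩, fun b hb => ⟨?_, ?_⟩, fun a ha => ⟨?_, ?_⟩⟩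
  · rw [← hB]
    refine (isPathEndpointIn_card_of_adj_of_ne hb₁ hb₂ hbne (by omega) ?_ hb).isPathEndpoint
    intro x hx y hy hxy hne
    refine ⟨hxy, fun h => hne ?_⟩
    simpa using (hBB x hx y hy).mp h
  · rintro y ⟨w, p, hp, rfl⟩
    have hclosed : ∀ x ∈ (B : Set _), ∀ z, (⊤ \ R).Adj x z → z ∈ (B : Set _) := by
      intro x hx z hz
      by_contra hzB
      have hzA : z ∈ A := by
        by_contra hzA
        exact hzB ((hnA z).mp hzA)
      exact hz.2 (hAB z hzA x hx).symm
    have hsub := p.forall_mem_support_of_closed hclosed hb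
    rw [← SimpleGraph.Walk.length_support, ← hB,
      ← List.toFinset_card_of_nodup hp.support_nodup]
    exact Finset.card_le_card fun x hx => hsub x (List.mem_toFinset.mp hx)
  · have end_case : ∀ c ∈ B, ∀ d ∈ B, R.Adj c d → IsPathEndpoint R c (k - 1) := by
      intro c hc d hd hcd
      have hBc := Finset.card_erase_add_one hc
      have h := alternating A subset_rfl (B.erase c) (Finset.erase_subset _ _) (by omega) d
        (Finset.mem_erase.mpr ⟨hcd.ne', hd⟩)
      have h' := (h.mono (T := Finset.univ.erase c) (by have := hnA c; grind)).cons hcd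
        (Finset.mem_univ c)
      rw [show k - 1 = 2 * A.card + 1 + 1 by omega]
      exact h'.isPathEndpoint
    by_cases h1 : b = b₁
    · exact h1 ▸ end_case b₁ hb₁ b₂ hb₂ hred
    by_cases h2 : b = b₂
    · exact h2 ▸ end_case b₂ hb₂ b₁ hb₁ hred.symm
    obtain ⟨a, ha⟩ : A.Nonempty := by rw [← Finset.card_pos]; omega
    have hBb := Finset.card_erase_add_one hb
    have hBb₁ := Finset.card_erase_add_one (Finset.mem_erase.mpr ⟨Ne.symm h1, hb₁⟩)
    have hAa := Finset.card_erase_add_one ha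
    have h := alternating (A.erase a) (Finset.erase_subset _ _) ((B.erase b).erase b₁)
      ((Finset.erase_subset _ _).trans (Finset.erase_subset _ _)) (by omega) b₂
      (by simp [hbne.symm, Ne.symm h2, hb₂])
    have hab : a ≠ b := (hAB a ha b hb).ne
    have h' := (((h.mono (T := ((Finset.univ.erase b).erase a).erase b₁) (by grind)).cons hred
      (by simp [(hAB a ha b₁ hb₁).ne', Ne.symm h1])).cons
      (hAB a ha b₁ hb₁) (by simp [hab])).cons (hAB a ha b hb).symm (Finset.mem_univ b)
    rw [show k - 1 = 2 * (A.erase a).card + 1 + 1 + 1 + 1 by omega]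
    exact h'.isPathEndpoint
  · rintro y ⟨w, p, hp, rfl⟩
    have := hp.length_add_one_le hedge
    rw [if_neg ((hnA b).mpr hb)] at this
    omega
  · have hBb₁ := Finset.card_erase_add_one hb₁
    have hAa := Finset.card_erase_add_one ha
    have h := alternating (A.erase a) (Finset.erase_subset _ _) (B.erase b₁)
      (Finset.erase_subset _ _) (by omega) b₂ (by simp [hbne.symm, hb₂])
    have h' := ((h.mono (T := (Finset.univ.erase a).erase b₁) (by
      have := hnA a; have := hnA b₁; grind)).cons hred
      (by simp [(hAB a ha b₁ hb₁).ne'])).cons (hAB a ha b₁ hb₁) (Finset.mem_univ a)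
    rw [show k - 2 = 2 * (A.erase a).card + 1 + 1 + 1 by omega]
    exact h'.isPathEndpoint
  · rintro y ⟨w, p, hp, rfl⟩
    have := hp.length_add_one_le hedge
    rw [if_pos ha] at this
    omega
end

section
/- Let k be even with 4 ≤ k < ℓ and r = ℓ + k/2 − 2, and let H be the graph obtained from two vertex-disjoint copies of the complete graph K_r by adding a single edge (u, v) with u in one copy and v in the other. Then in every (P_k, P_ℓ)-good red/blue coloring of H, the edge (u, v) is colored blue. -/
/-- Two disjoint copies of K_r joined by the single bridge edge (inl u, inr v). -/
def twoCliquesBridge (r : ℕ) (u v : Fin r) : SimpleGraph (Fin r ⊕ Fin r) :=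
  SimpleGraph.fromRel (fun x y =>
    (∃ a b, x = Sum.inl a ∧ y = Sum.inl b) ∨
    (∃ a b, x = Sum.inr a ∧ y = Sum.inr b) ∨
    (x = Sum.inl u ∧ y = Sum.inr v))

/-- The vertices of `l` form, in this order, a path in `G`. -/
def IsPathList {V : Type*} (G : SimpleGraph V) (l : List V) : Prop :=
  l.IsChain G.Adj ∧ l.Nodup

namespace IsPathList

variable {V : Type*} {G : SimpleGraph V} {l l₁ l₂ : List V} {a x : V}

theorem append_iff : IsPathList G (l₁ ++ l₂) ↔ IsPathList G l₁ ∧ IsPathList G l₂ ∧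
    l₁.Disjoint l₂ ∧ ∀ x ∈ l₁.getLast?, ∀ y ∈ l₂.head?, G.Adj x y := by
  simp only [IsPathList, List.isChain_append, List.nodup_append']
  tauto

theorem cons_iff : IsPathList G (a :: l) ↔
    IsPathList G l ∧ a ∉ l ∧ ∀ y ∈ l.head?, G.Adj a y := by
  simp only [IsPathList, List.isChain_cons, List.nodup_cons]
  tauto

theorem nil : IsPathList G [] := by simp [IsPathList]

theorem singleton (a : V) : IsPathList G [a] := by simp [IsPathList]

theorem reverse (h : IsPathList G l) : IsPathList G l.reverse := by
  refine ⟨?_, List.nodup_reverse.2 h.2⟩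
  rw [List.isChain_reverse]
  exact h.1.imp fun _ _ hab => hab.symm

theorem hasNPath (h : IsPathList G l) (hl : l ≠ []) : HasNPath G l.length := by
  have hlen := SimpleGraph.Walk.length_ofSupport hl h.1
  have : 0 < l.length := List.length_pos_iff.2 hl
  refine ⟨_, _, .ofSupport l hl h.1, ?_, by omega⟩
  rw [SimpleGraph.Walk.isPath_def, SimpleGraph.Walk.support_ofSupport]
  exact h.2

theorem append_cons_append (h₁ : IsPathList G l₁) (h₂ : IsPathList G l₂) (hd : l₁.Disjoint l₂)
    (hx₁ : x ∉ l₁) (hx₂ : x ∉ l₂) (ha : ∀ a ∈ l₁.getLast?, G.Adj a x)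
    (hb : ∀ b ∈ l₂.head?, G.Adj b x) : IsPathList G (l₁ ++ x :: l₂) := by
  rw [append_iff, cons_iff]
  refine ⟨h₁, ⟨h₂, hx₂, fun y hy => (hb y hy).symm⟩, ?_, ?_⟩
  · simpa [List.disjoint_cons_right] using ⟨hx₁, hd⟩
  · simpa using ha

end IsPathList

/-- Both ends of the list `l` lie in `W`. -/
def HasEndsIn {V : Type*} (W l : List V) : Prop :=
  (∀ x ∈ l.head?, x ∈ W) ∧ ∀ x ∈ l.getLast?, x ∈ W

theorem HasEndsIn.mono {V : Type*} {W W' l : List V} (h : HasEndsIn W l)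
    (hW : ∀ x ∈ W, x ∈ W') : HasEndsIn W' l :=
  ⟨fun x hx => hW x (h.1 x hx), fun x hx => hW x (h.2 x hx)⟩

theorem HasEndsIn.append {V : Type*} {W l l' : List V} (h : HasEndsIn W l)
    (hl' : ∀ x ∈ l'.getLast?, x ∈ W) (hl : l ≠ []) (z : V) (hn : l' ≠ []) :
    HasEndsIn W (l ++ z :: l') := by
  constructor
  · simpa [List.head?_append_of_ne_nil _ hl] using h.1
  · have : (l ++ z :: l').getLast? = l'.getLast? := by
      rw [List.append_cons, List.getLast?_append_of_ne_nil _ hn]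
    rwa [this]

/-- The vertices of the pairs in `D`, in order. -/
def flat {V : Type*} (D : List (V × V)) : List V := D.flatMap fun d => [d.1, d.2]

theorem exists_two_paths {V : Type*} {G : SimpleGraph V} (a b : V) (W : List V) (D : List (V × V))
    (hlen : W.length ≤ D.length) (hnd : (a :: b :: W ++ flat D).Nodup)
    (hadj : ∀ d ∈ D, ∀ w ∈ a :: b :: W, G.Adj w d.1 ∨ G.Adj w d.2) :
    ∃ l₁ l₂ : List V, l₁ ≠ [] ∧ l₂ ≠ [] ∧ IsPathList G l₁ ∧ IsPathList G l₂ ∧ l₁.Disjoint l₂ ∧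
      (∀ x ∈ l₁ ++ l₂, x ∈ a :: b :: W ++ flat D) ∧ (∀ x ∈ a :: b :: W, x ∈ l₁ ++ l₂) ∧
      l₁.length + l₂.length = 2 * W.length + 2 ∧
      HasEndsIn (a :: b :: W) l₁ ∧ HasEndsIn (a :: b :: W) l₂ := by
  induction W generalizing D with
  | nil =>
    refine ⟨[a], [b], by simp, by simp, .singleton a, .singleton b, ?_, ?_, ?_, ?_, ?_, ?_⟩ <;>
      simp_all [HasEndsIn, flat]
    tauto
  | cons c W ih =>
    obtain _ | ⟨⟨d, e⟩, D⟩ := D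
    · simp at hlen
    have hfl : flat ((d, e) :: D) = d :: e :: flat D := by simp [flat]
    rw [hfl] at hnd ⊢
    obtain ⟨l₁, l₂, hn₁, hn₂, h₁, h₂, hdis, hsub, hcov, hl, he₁, he₂⟩ := ih D (by simpa using hlen)
      (by simp at hnd ⊢; grind) (by simp at hadj ⊢; grind)
    clear ih
    have hc : c ∉ l₁ ++ l₂ := fun h => by have := hsub c h; simp at hnd this; grind
    have hd : d ∉ l₁ ++ l₂ := fun h => by have := hsub d h; simp at hnd this; grind
    have he : e ∉ l₁ ++ l₂ := fun h => by have := hsub e h; simp at hnd this; grind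
    obtain ⟨a', ha'⟩ : ∃ a', l₁.getLast? = some a' := by
      cases h : l₁.getLast? <;> simp_all
    obtain ⟨b', hb'⟩ : ∃ b', l₂.getLast? = some b' := by
      cases h : l₂.getLast? <;> simp_all
    have haW : a' ∈ a :: b :: W := he₁.2 a' ha'
    have hbW : b' ∈ a :: b :: W := he₂.2 b' hb'
    obtain ⟨t, ht, hpair⟩ : ∃ t, (t = d ∨ t = e) ∧ ((G.Adj a' t ∧ G.Adj c t) ∨
        (G.Adj b' t ∧ G.Adj c t) ∨ (G.Adj a' t ∧ G.Adj b' t)) := by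
      have h1 := hadj (d, e) (by simp) a' (by simp at haW ⊢; tauto)
      have h2 := hadj (d, e) (by simp) b' (by simp at hbW ⊢; tauto)
      have h3 := hadj (d, e) (by simp) c (by simp)
      grind
    have htl : t ∉ l₁ ++ l₂ := by grind
    have htc : t ≠ c := by simp at hnd; grind
    simp only [List.mem_append, not_or] at htl hc
    suffices ∃ m₁ m₂ : List V, m₁ ≠ [] ∧ m₂ ≠ [] ∧ IsPathList G m₁ ∧ IsPathList G m₂ ∧
        m₁.Disjoint m₂ ∧ (∀ x, x ∈ m₁ ++ m₂ ↔ x = c ∨ x = t ∨ x ∈ l₁ ++ l₂) ∧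
        m₁.length + m₂.length = l₁.length + l₂.length + 2 ∧
        HasEndsIn (c :: a :: b :: W) m₁ ∧ HasEndsIn (c :: a :: b :: W) m₂ by
      obtain ⟨m₁, m₂, hm₁, hm₂, g₁, g₂, gd, hmem, hml, e₁, e₂⟩ := this
      have hW : ∀ x ∈ c :: a :: b :: W, x ∈ a :: b :: c :: W := by
        intro x; simp only [List.mem_cons]; clear * -; tauto
      refine ⟨m₁, m₂, hm₁, hm₂, g₁, g₂, gd, fun x hx => ?_, fun x hx => ?_, ?_,
        e₁.mono hW, e₂.mono hW⟩
      · have h1 := (hmem x).1 hx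
        have h2 := hsub x
        simp only [List.mem_cons, List.mem_append] at h1 h2 ⊢
        clear * - h1 h2 ht
        grind
      · have h1 := (hmem x).2
        have h2 := hcov x
        simp only [List.mem_cons, List.mem_append] at h1 h2 hx ⊢
        clear * - h1 h2 hx
        grind
      · simp only [List.length_cons]; omega
    have hc₀ : ∀ x ∈ a :: b :: W, x ∈ c :: a :: b :: W := fun x => List.mem_cons_of_mem c
    replace he₁ := he₁.mono hc₀
    replace he₂ := he₂.mono hc₀
    clear hnd hadj hsub hcov haW hbW
    rcases hpair with ⟨hat, hct⟩ | ⟨hbt, hct⟩ | ⟨hat, hbt⟩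
    · refine ⟨l₁ ++ t :: [c], l₂, by simp, hn₂, ?_, h₂, ?_, ?_, ?_,
        he₁.append (by simp) hn₁ t (by simp), he₂⟩
      · apply h₁.append_cons_append (.singleton c) <;> simp_all
      · simp_all
      · intro x; simp; clear * -; tauto
      · simp; omega
    · refine ⟨l₁, l₂ ++ t :: [c], hn₁, by simp, h₁, ?_, ?_, ?_, ?_, he₁,
        he₂.append (by simp) hn₂ t (by simp)⟩
      · apply h₂.append_cons_append (.singleton c) <;> simp_all
      · simp_all
      · intro x; simp; clear * -; tauto
      · simp; omega
    · refine ⟨l₁ ++ t :: l₂.reverse, [c], by simp, by simp, ?_, .singleton c, ?_, ?_, ?_,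
        he₁.append (by simpa [hn₂] using he₂.1) hn₁ t (by simpa), by simp [HasEndsIn]⟩
      · apply h₁.append_cons_append h₂.reverse <;> simp_all
      · simpa using ⟨hc.1, htc.symm, hc.2⟩
      · intro x; simp; clear * -; tauto
      · simp; omega

theorem exists_path_through {V : Type*} {G : SimpleGraph V} {W : List V} (hW : W ≠ [])
    {D : List (V × V)} {z : V}
    (hlen : W.length ≤ D.length + 2) (hnd : (W ++ z :: flat D).Nodup)
    (hadj : ∀ d ∈ D, ∀ w ∈ W, G.Adj w d.1 ∨ G.Adj w d.2) (hz : ∀ w ∈ W, G.Adj w z) :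
    ∃ l : List V, l ≠ [] ∧ IsPathList G l ∧ (∀ x ∈ l, x ∈ W ++ z :: flat D) ∧ (∀ x ∈ W, x ∈ l) ∧
      l.length + 1 = 2 * W.length ∧ HasEndsIn W l := by
  obtain _ | ⟨a, _ | ⟨b, W⟩⟩ := W
  · contradiction
  · exact ⟨[a], by simp, .singleton a, by simp, by simp, by simp, by simp [HasEndsIn]⟩
  · obtain ⟨l₁, l₂, hn₁, hn₂, h₁, h₂, hd, hsub, hcov, hl, e₁, e₂⟩ := exists_two_paths a b W D
      (by simpa using hlen) (hnd.sublist (by simp)) hadj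
    have hzl : z ∉ l₁ ++ l₂ := fun h => by
      have := hsub z h
      simp [List.nodup_append] at hnd this
      clear * - hnd this
      grind
    simp only [List.mem_append, not_or] at hzl
    refine ⟨l₁ ++ z :: l₂, by simp, ?_, fun x hx => ?_, fun x hx => ?_, by simp; omega,
      e₁.append e₂.2 hn₁ z hn₂⟩
    · exact h₁.append_cons_append h₂ hd hzl.1 hzl.2 (fun w hw => hz w (e₁.2 w hw))
        (fun w hw => hz w (e₂.1 w hw))
    · have := hsub x
      simp only [List.mem_append, List.mem_cons] at hx this ⊢
      clear * - hx this
      tauto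
    · have := hcov x hx
      simp only [List.mem_append, List.mem_cons] at this ⊢
      clear * - this
      tauto

theorem List.IsChain.of_eq_append {α : Type*} {ρ : α → α → Prop} {l l₁ l₂ l₃ : List α}
    (h : l.IsChain ρ) (hl : l = l₁ ++ l₂ ++ l₃) : l₂.IsChain ρ :=
  (hl ▸ h).left_of_append.right_of_append

theorem exists_pairs {V : Type*} {ρ : V → V → Prop} :
    ∀ l : List V, l.IsChain ρ → ∃ D : List (V × V),
      D.length = l.length / 2 ∧ (flat D).Sublist l ∧ ∀ d ∈ D, ρ d.1 d.2
  | [], _ => ⟨[], by simp [flat]⟩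
  | [_], _ => ⟨[], by simp [flat]⟩
  | x :: y :: l, h => by
    rw [List.isChain_cons_cons] at h
    obtain ⟨D, hD, hsub, hρ⟩ := exists_pairs l h.2.tail
    refine ⟨(x, y) :: D, by simp; omega, by simpa [flat] using hsub, ?_⟩
    simpa using ⟨h.1, fun a b => hρ (a, b)⟩

/-- `P` is a path list of maximum length in `G`. -/
def IsLongestPath {V : Type*} (G : SimpleGraph V) (P : List V) : Prop :=
  IsPathList G P ∧ ∀ Q, IsPathList G Q → Q.length ≤ P.length

namespace IsLongestPath

variable {V : Type*} {R B : SimpleGraph V} {P W : List V} {a v : V}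

theorem reverse (h : IsLongestPath B P) : IsLongestPath B P.reverse :=
  ⟨h.1.reverse, by simpa using h.2⟩

theorem adj_getLast (h : IsLongestPath B P) (hRB : ∀ x y, x ≠ y → R.Adj x y ∨ B.Adj x y)
    (ha : a ∉ P) : ∀ x ∈ P.getLast?, R.Adj a x := by
  intro x hx
  by_contra hR
  have hxP : x ∈ P := List.mem_of_mem_getLast? hx
  have hB := (hRB a x (by rintro rfl; exact ha hxP)).resolve_left hR
  have := h.2 (P ++ [a]) <| by
    refine IsPathList.append_iff.2 ⟨h.1, .singleton a, by simpa using ha, ?_⟩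
    intro y hy
    obtain rfl : y = x := by simp_all
    simpa using hB.symm
  simp at this

theorem adj_head (h : IsLongestPath B P) (hRB : ∀ x y, x ≠ y → R.Adj x y ∨ B.Adj x y)
    (ha : a ∉ P) : ∀ x ∈ P.head?, R.Adj a x := by
  simpa using h.reverse.adj_getLast hRB (a := a) (by simpa using ha)

theorem isChain (h : IsLongestPath B P) (hRB : ∀ x y, x ≠ y → R.Adj x y ∨ B.Adj x y)
    (hW : ∀ a ∈ W, a ∉ P) : P.IsChain fun x y => ∀ a ∈ W, R.Adj a x ∨ R.Adj a y := by
  refine List.isChain_iff_forall_rel_of_append_cons_cons.2 fun x y A C hP a ha => ?_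
  by_contra! hR
  have haP := hW a ha
  subst hP
  have hx := (hRB a x (by rintro rfl; simp at haP)).resolve_left hR.1
  have hy := (hRB a y (by rintro rfl; simp at haP)).resolve_left hR.2
  have := h.2 (A ++ x :: a :: y :: C) <| by
    have := h.1
    simp only [IsPathList.append_iff, IsPathList.cons_iff] at this ⊢
    simp only [List.mem_append, List.mem_cons, not_or] at haP
    simp_all [hx.symm, eq_comm]
  simp at this

theorem exists_path_of_le {p q : V} {M : List V} (h : IsLongestPath B (p :: M ++ [q]))
    (hRB : ∀ x y, x ≠ y → R.Adj x y ∨ B.Adj x y)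
    (hW : ∀ a ∈ W, a ∉ p :: M ++ [q]) (hWn : W.Nodup) (hW₀ : W ≠ [])
    (hlen : W.length ≤ M.length / 2 + 2) :
    ∃ l, IsPathList R l ∧ l.length = 2 * W.length ∧ (∀ x ∈ W, x ∈ l) ∧ q ∈ l := by
  have hchain := h.isChain hRB hW
  have hMchain := hchain.of_eq_append (l₁ := [p]) (l₂ := M) (l₃ := [q]) (by simp)
  obtain ⟨D, hD, hsub, hadj⟩ := exists_pairs M hMchain
  have hPn := h.1.2
  have hs : (p :: flat D ++ [q]).Sublist (p :: M ++ [q]) := by simpa using hsub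
  have hn := hPn.sublist hs
  have hWD : ∀ a ∈ W, a ∉ p :: flat D ++ [q] := fun a ha h => hW a ha (hs.subset h)
  obtain ⟨l, hl₀, hl, hls, hlW, hll, hle⟩ := exists_path_through (G := R) hW₀ (z := p) (D := D)
    (by omega) (by simp_all [List.nodup_append]; grind) hadj
    (fun w hw => h.adj_head hRB (hW w hw) p (by simp))
  refine ⟨l ++ [q], IsPathList.append_iff.2 ⟨hl, .singleton q, ?_, ?_⟩, by simp; omega,
    fun x hx => by simp [hlW x hx], by simp⟩
  · rw [List.disjoint_singleton]
    intro hq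
    have := hls q hq
    have := hWD q
    simp_all [List.nodup_append]
    grind
  · intro x hx y hy
    obtain rfl : q = y := by simpa using hy
    exact h.adj_getLast hRB (hW x (hle.2 x hx)) q (by rw [List.getLast?_concat]; rfl)

end IsLongestPath

theorem IsPathList.exists_cons_of_mem {V : Type*} {G : SimpleGraph V} {l : List V} {t v : V} {m : ℕ}
    (hl : IsPathList G l) (ht : t ∈ l) (hv : v = t ∨ G.Adj v t) (hm : 2 * m ≤ l.length + 2) :
    ∃ l', IsPathList G (v :: l') ∧ m ≤ l'.length + 1 := by
  have key : ∀ u ∈ l, ∃ l', IsPathList G (u :: l') ∧ (∀ x ∈ l', x ∈ l) ∧ m ≤ l'.length + 1 := by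
    intro u hu
    obtain ⟨A, C, rfl⟩ := List.append_of_mem hu
    by_cases hC : m ≤ C.length + 1
    · exact ⟨C, (append_iff.1 hl).2.1, by simp; tauto, hC⟩
    · have hr := hl.reverse
      simp only [List.reverse_append, List.reverse_cons, List.append_assoc] at hr
      refine ⟨A.reverse, (append_iff.1 hr).2.1, by simp; tauto, ?_⟩
      simp at hm ⊢
      omega
  by_cases hvl : v ∈ l
  · obtain ⟨l', h, -, h'⟩ := key v hvl
    exact ⟨l', h, h'⟩
  · obtain ⟨l', h, hs, h'⟩ := key t ht
    have hvt : v ≠ t := by rintro rfl; exact hvl ht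
    refine ⟨t :: l', cons_iff.2 ⟨h, ?_, by simpa using hv.resolve_left hvt⟩, by simp; omega⟩
    simpa [hvt] using fun h => hvl (hs v h)

theorem flat_append {V : Type*} (D₁ D₂ : List (V × V)) : flat (D₁ ++ D₂) = flat D₁ ++ flat D₂ :=
  List.flatMap_append

open Classical in
theorem List.perm_of_count_eq {α : Type*} {l₁ l₂ : List α} (h : ∀ a, l₁.count a = l₂.count a) :
    l₁.Perm l₂ :=
  List.perm_iff_count.2 h

namespace IsLongestPath

variable {V : Type*} {R B : SimpleGraph V} {P W : List V} {a v : V}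

theorem exists_path_of_blue {p q x : V} {A C : List V} {m : ℕ}
    (h : IsLongestPath B ((p :: A ++ [x]) ++ v :: C))
    (hRB : ∀ x y, x ≠ y → R.Adj x y ∨ B.Adj x y)
    (hW : ∀ a ∈ W, a ∉ (p :: A ++ [x]) ++ v :: C) (hWn : W.Nodup) (hW₀ : W ≠ [])
    (hWm : W.length + 1 = m) (hm : 2 * m ≤ A.length + C.length + 3)
    (hq : C.getLast? = some q)
    (hvW : ∀ w ∈ W, B.Adj v w) :
    ∃ l, IsPathList R l ∧ l.length = 2 * m := by
  have hchain := h.isChain hRB hW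
  obtain ⟨hA, hvC, hdis, hxv⟩ := IsPathList.append_iff.1 h.1
  obtain ⟨hC, hvC', -⟩ := IsPathList.cons_iff.1 hvC
  have hPn := h.1.2
  replace hxv : B.Adj x v := hxv x (by rw [List.getLast?_concat]; rfl) v (by simp)
  have hWp : ∀ a ∈ W, R.Adj a p := fun a ha => h.adj_head hRB (hW a ha) p (by simp)
  have hlast : (p :: A ++ [x] ++ v :: C).getLast? = some q := by
    rw [List.getLast?_append_of_ne_nil _ (by simp), List.getLast?_cons, hq]; rfl
  have hWq : ∀ a ∈ W, R.Adj a q := fun a ha => h.adj_getLast hRB (hW a ha) q (by rw [hlast]; rfl)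
  have hWx : ∀ a ∈ W, R.Adj a x := by
    intro a ha
    by_contra hR
    have hax : a ≠ x := by rintro rfl; exact hW a ha (by simp)
    have hB := (hRB a x hax).resolve_left hR
    have := h.2 ((p :: A ++ [x]) ++ a :: v :: C) <| by
      rw [IsPathList.append_iff, IsPathList.cons_iff]
      have := hW a ha
      refine ⟨hA, ⟨hvC, by simp_all, by simpa using (hvW a ha).symm⟩, ?_, ?_⟩
      · simp_all
      · intro u hu w hw
        rw [List.getLast?_concat] at hu
        simp at hu hw
        subst hu hw
        exact hB.symm
    simp at this
  have hWy : ∀ a ∈ W, ∀ y ∈ C.head?, R.Adj a y := by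
    intro a ha y hy
    by_contra hR
    have hyC : y ∈ C := List.mem_of_mem_head? hy
    have hay : a ≠ y := by rintro rfl; exact hW a ha (by simp [hyC])
    have hB := (hRB a y hay).resolve_left hR
    have := h.2 ((p :: A ++ [x]) ++ v :: a :: C) <| by
      rw [IsPathList.append_iff, IsPathList.cons_iff, IsPathList.cons_iff]
      have := hW a ha
      refine ⟨hA, ⟨⟨hC, by simp_all, ?_⟩, ?_, ?_⟩, ?_, ?_⟩
      · intro w hw
        obtain rfl : y = w := by simp_all
        exact hB
      · simp only [List.mem_cons, not_or]
        exact ⟨(hvW a ha).ne, hvC'⟩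
      · simpa using hvW a ha
      · simp_all
      · intro u hu w hw
        rw [List.getLast?_concat] at hu
        simp at hu hw
        subst hu hw
        exact hxv
    simp at this
  have hqp : R.Adj q p := by
    by_contra hR
    obtain ⟨a, ha⟩ := List.exists_mem_of_ne_nil W hW₀
    have hqC : q ∈ C := List.mem_of_mem_getLast? hq
    have hqp : q ≠ p := by rintro rfl; exact hdis (a := q) (by simp) (by simp [hqC])
    have hB := (hRB q p hqp).resolve_left hR
    have := h.2 (a :: v :: ((p :: A ++ [x]).reverse ++ C.reverse)) <| by
      rw [IsPathList.cons_iff, IsPathList.cons_iff, IsPathList.append_iff]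
      have := hW a ha
      refine ⟨⟨⟨hA.reverse, hC.reverse, ?_, ?_⟩, ?_, ?_⟩, ?_, ?_⟩
      · clear * - hdis
        simp_all
      · intro u hu w hw
        rw [List.getLast?_reverse] at hu
        rw [List.head?_reverse, hq] at hw
        simp at hu hw
        subst hu hw
        exact hB.symm
      · clear * - hdis hvC'
        simp_all
      · simpa using hxv.symm
      · have := (hvW a ha).ne'
        simp_all
      · simpa using (hvW a ha).symm
    simp at this
    omega
  suffices ∃ l, IsPathList R l ∧ HasEndsIn W l ∧ l ≠ [] ∧ l.length + 1 = 2 * W.length ∧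
      (x ∉ l ∧ q ∉ l ∧ p ∉ l) by
    obtain ⟨l, hl, hle, hl₀, hlen, hxl, hql, hpl⟩ := this
    have hqC : q ∈ C := List.mem_of_mem_getLast? hq
    have hxq : x ≠ q := by rintro rfl; exact hdis (a := x) (by simp) (by simp [hqC])
    have hxp : x ≠ p := by rintro rfl; simp at hPn
    refine ⟨x :: (l ++ [q, p]), ?_, by simp; omega⟩
    rw [IsPathList.cons_iff, IsPathList.append_iff, IsPathList.cons_iff]
    refine ⟨⟨hl, ⟨.singleton p, by simpa using hqp.ne, by simpa using hqp⟩, ?_, ?_⟩, ?_, ?_⟩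
    · simp [hql, hpl]
    · intro u hu w hw
      obtain rfl : q = w := by simpa using hw
      exact hWq u (hle.2 u hu)
    · simp [hxl, hxq, hxp]
    · intro u hu
      rw [List.head?_append_of_ne_nil _ hl₀] at hu
      exact (hWx u (hle.1 u hu)).symm
  suffices W.length = 1 ∨ ∃ z D, (z :: flat D ++ [x, q, p]).Nodup ∧
      (∀ a ∈ W, a ∉ z :: flat D ++ [x, q, p]) ∧ W.length ≤ D.length + 2 ∧
      (∀ d ∈ D, ∀ w ∈ W, R.Adj w d.1 ∨ R.Adj w d.2) ∧ ∀ w ∈ W, R.Adj w z by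
    rcases this with hW₁ | ⟨z, D, hn, hWz, hlen, hD, hz⟩
    · obtain ⟨a, rfl⟩ := List.length_eq_one_iff.1 hW₁
      refine ⟨[a], .singleton a, by simp [HasEndsIn], by simp, by simp, ?_⟩
      simp only [List.mem_singleton]
      exact ⟨(hWx a (by simp)).ne', (hWq a (by simp)).ne', (hWp a (by simp)).ne'⟩
    · obtain ⟨l, hl₀, hl, hls, -, hll, hle⟩ := exists_path_through (G := R) hW₀ (z := z) (D := D)
        hlen (by
          refine List.nodup_append.2 ⟨hWn, hn.sublist (by simp), ?_⟩
          rintro a ha b hb rfl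
          exact hWz a ha (List.mem_append_left _ hb)) hD hz
      have key : ∀ u ∈ [x, q, p], u ∉ l := by
        intro u hu hul
        rcases List.mem_append.1 (hls u hul) with h1 | h1
        · exact hWz u h1 (List.mem_append_right _ hu)
        · exact (List.disjoint_of_nodup_append hn) h1 hu
      exact ⟨l, hl, hle, hl₀, hll, key x (by simp), key q (by simp), key p (by simp)⟩
  rw [or_iff_not_imp_left]
  intro hW₁
  have hWl : 0 < W.length := List.length_pos_iff.2 hW₀
  suffices ∃ z D, (∃ L, (z :: flat D ++ [x, q, p]).Perm L ∧
      L.Sublist ((p :: A ++ [x]) ++ v :: C)) ∧ W.length ≤ D.length + 2 ∧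
      (∀ d ∈ D, ∀ w ∈ W, R.Adj w d.1 ∨ R.Adj w d.2) ∧ ∀ w ∈ W, R.Adj w z by
    obtain ⟨z, D, ⟨L, hL, hLs⟩, h'⟩ := this
    exact ⟨z, D, hL.nodup_iff.2 (hPn.sublist hLs),
      fun a ha haL => hW a ha (hLs.subset (hL.subset haL)), h'⟩
  obtain ⟨C', rfl⟩ : ∃ C', C = C' ++ [q] := by
    simpa [eq_comm] using (List.getLast?_eq_some_iff.1 hq)
  obtain _ | ⟨y, C'⟩ := C'
  · obtain _ | ⟨c, _ | ⟨d, A⟩⟩ := A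
    · simp at hm; omega
    · simp at hm; omega
    obtain ⟨D, hD, hDs, hDR⟩ := exists_pairs A
      (hchain.of_eq_append (l₁ := [p, c, d]) (l₂ := A) (l₃ := [x, v, q]) (by simp))
    have hz : (∀ w ∈ W, R.Adj w c) ∨ ∀ w ∈ W, R.Adj w d := by
      by_contra! hcd
      obtain ⟨⟨a, ha, hac⟩, b, hb, hbd⟩ := hcd
      have hab : a ≠ b := by
        rintro rfl
        simp only [List.cons_append, List.isChain_cons_cons] at hchain
        exact (hchain.2.1 a ha).elim hac hbd
      have haP := hW a ha
      have hbP := hW b hb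
      have hca := ((hRB a c (by rintro rfl; simp at haP)).resolve_left hac).symm
      have hbd := (hRB b d (by rintro rfl; simp at hbP)).resolve_left hbd
      have hva := hvW a ha
      have hvb := hvW b hb
      have hpc : B.Adj p c := by
        have := hA.1
        simp only [List.cons_append, List.isChain_cons_cons] at this
        exact this.1
      have hda : IsPathList B (d :: A ++ [x]) := by
        have := hA
        simp only [List.cons_append] at this
        rw [IsPathList.cons_iff, IsPathList.cons_iff] at this
        exact this.1.1
      have := h.2 (p :: c :: a :: v :: b :: (d :: A ++ [x])) <| by
        refine ⟨?_, ?_⟩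
        · simp only [List.cons_append, List.isChain_cons_cons]
          exact ⟨hpc, hca, hva.symm, hvb, hbd, hda.1⟩
        · clear * - hPn haP hbP hab hva hvb
          simp [List.nodup_append] at hPn haP hbP ⊢
          grind
      simp at this
    rcases hz with hz | hz
    · refine ⟨c, D, ⟨(p :: c :: flat D) ++ [x] ++ [q], ?_, ?_⟩, ?_, hDR, hz⟩
      · exact List.perm_of_count_eq fun e => by
          simp only [List.count_append, List.count_cons, List.count_nil]; ring
      · exact ((((hDs.cons d).cons_cons c).cons_cons p).append (List.Sublist.refl [x])).append
          ((List.Sublist.refl [q]).cons v)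
      · simp at hm; omega
    · refine ⟨d, D, ⟨(p :: d :: flat D) ++ [x] ++ [q], ?_, ?_⟩, ?_, hDR, hz⟩
      · exact List.perm_of_count_eq fun e => by
          simp only [List.count_append, List.count_cons, List.count_nil]; ring
      · exact ((((hDs.cons_cons d).cons c).cons_cons p).append (.refl [x])).append
          ((List.Sublist.refl [q]).cons v)
      · simp at hm; omega
  · obtain ⟨D₁, hD₁, hDs₁, hDR₁⟩ := exists_pairs A
      (hchain.of_eq_append (l₁ := [p]) (l₂ := A) (l₃ := [x, v] ++ y :: C' ++ [q]) (by simp))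
    obtain ⟨D₂, hD₂, hDs₂, hDR₂⟩ := exists_pairs C'
      (hchain.of_eq_append (l₁ := p :: A ++ [x, v, y]) (l₂ := C') (l₃ := [q]) (by simp))
    refine ⟨y, D₁ ++ D₂, ⟨((p :: flat D₁) ++ [x]) ++ ((y :: flat D₂) ++ [q]), ?_, ?_⟩, ?_, ?_, ?_⟩
    · exact List.perm_of_count_eq fun e => by
        simp only [List.count_append, List.count_cons, List.count_nil, flat_append]; ring
    · exact ((hDs₁.cons_cons p).append (.refl [x])).append
        (((hDs₂.cons_cons y).append (.refl [q])).cons v)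
    · simp at hm ⊢; omega
    · intro d hd
      exact (List.mem_append.1 hd).elim (hDR₁ d) (hDR₂ d)
    · exact fun w hw => hWy w hw y (by simp)

end IsLongestPath

theorem IsPathList.length_lt {V : Type*} {G : SimpleGraph V} {n : ℕ} (hn : n ≠ 0)
    (hG : ¬ HasNPath G n) {l : List V} (hl : IsPathList G l) : l.length < n := by
  by_contra! hlen
  have htake : (l.take n).length = n := by simpa using hlen
  refine hG (htake ▸ IsPathList.hasNPath ⟨hl.1.take n, hl.2.sublist (List.take_sublist n l)⟩ ?_)
  exact List.ne_nil_of_length_pos (by omega)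

theorem IsPathList.map {V V' : Type*} {G : SimpleGraph V} (f : V' ↪ V) {l : List V'}
    (hl : IsPathList (G.comap f) l) : IsPathList G (l.map f) :=
  ⟨(List.isChain_map f).2 hl.1, hl.2.map f.injective⟩

theorem exists_isLongestPath {V : Type*} [Fintype V] (G : SimpleGraph V) :
    ∃ P, IsLongestPath G P := by
  let S : Set ℕ := {n | ∃ l, IsPathList G l ∧ l.length = n}
  have hb : BddAbove S := ⟨Fintype.card V, by
    rintro _ ⟨l, hl, rfl⟩
    exact hl.2.length_le_card⟩
  obtain ⟨P, hP, hlen⟩ := Nat.sSup_mem (s := S) ⟨0, [], .nil, rfl⟩ hb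
  exact ⟨P, hP, fun Q hQ => hlen ▸ le_csSup hb ⟨Q, hQ, rfl⟩⟩

theorem List.Nodup.exists_nodup_disjoint {V : Type*} [Fintype V] {P : List V} (hP : P.Nodup)
    {n : ℕ} (hn : P.length + n ≤ Fintype.card V) :
    ∃ W : List V, W.Nodup ∧ W.length = n ∧ ∀ a ∈ W, a ∉ P := by
  classical
  have hcard : n ≤ (P.toFinsetᶜ).card := by
    rw [Finset.card_compl, List.toFinset_card_of_nodup hP]
    omega
  obtain ⟨s, hs, hsn⟩ := Finset.exists_subset_card_eq hcard
  refine ⟨s.toList, s.nodup_toList, by simpa using hsn, fun a ha => ?_⟩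
  simpa using hs (Finset.mem_toList.1 ha)

theorem List.exists_cons_append_singleton {V : Type*} {P : List V} (hP : 2 ≤ P.length) :
    ∃ p M q, P = p :: M ++ [q] := by
  obtain _ | ⟨p, P⟩ := P
  · simp at hP
  · obtain rfl | ⟨M, q, rfl⟩ := P.eq_nil_or_concat'
    · simp at hP
    · exact ⟨p, M, q, rfl⟩

namespace IsLongestPath

variable {V : Type*} {R B : SimpleGraph V} {P W : List V}

theorem card_le [Fintype V] (h : IsLongestPath B P)
    (hRB : ∀ x y, x ≠ y → R.Adj x y ∨ B.Adj x y) (hP : 2 ≤ P.length)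
    (hR : ∀ l, IsPathList R l → l.length ≤ P.length) :
    Fintype.card V ≤ P.length + P.length / 2 := by
  by_contra! hlt
  obtain ⟨W, hWn, hWl, hW⟩ := h.1.2.exists_nodup_disjoint (n := P.length / 2 + 1) (by omega)
  obtain ⟨p, M, q, rfl⟩ := List.exists_cons_append_singleton hP
  obtain ⟨l, hl, hlen, -⟩ := h.exists_path_of_le hRB hW hWn
    (List.ne_nil_of_length_pos (by omega)) (by simp at hWl; omega)
  have := hR l hl
  omega

theorem exists_path_from {m : ℕ} (h : IsLongestPath B P)
    (hRB : ∀ x y, x ≠ y → R.Adj x y ∨ B.Adj x y) (hW : ∀ a ∈ W, a ∉ P) (hWn : W.Nodup)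
    (hWm : W.length + 1 = m) (hm : 2 ≤ m) (hP : 2 * m ≤ P.length)
    (hR : ∀ l, IsPathList R l → l.length < 2 * m) (v : V) :
    ∃ l, IsPathList R (v :: l) ∧ m ≤ l.length + 1 := by
  by_contra hv
  have hW₀ : W ≠ [] := List.ne_nil_of_length_pos (by omega)
  have key : ∀ P, IsLongestPath B P → (∀ a ∈ W, a ∉ P) → 2 * m ≤ P.length →
      ∀ q ∈ P.getLast?, ∀ t, t ∈ W ∨ t = q → v ≠ t ∧ ¬ R.Adj v t := by
    intro P h hW hP q hq t ht
    obtain ⟨p, M, q', rfl⟩ := List.exists_cons_append_singleton (P := P) (by omega)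
    obtain rfl : q' = q := by
      rw [List.getLast?_concat] at hq
      simpa using hq
    obtain ⟨l, hl, hlen, hWl, hql⟩ := h.exists_path_of_le hRB hW hWn hW₀ (by simp at hP; omega)
    rw [ne_eq, ← not_or]
    intro hvt
    refine hv (hl.exists_cons_of_mem (t := t) ?_ hvt (by omega))
    rcases ht with ht | rfl
    · exact hWl t ht
    · exact hql
  have hP₀ : P ≠ [] := List.ne_nil_of_length_pos (by omega)
  have hlast := key P h hW hP _ (List.getLast?_eq_some_getLast hP₀)
  have hhead := key P.reverse h.reverse (by simpa using hW) (by simpa using hP) (P.head hP₀)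
    (by rw [List.getLast?_reverse]; exact List.head?_eq_some_head hP₀)
  have hvP : v ∈ P := by
    by_contra hvP
    exact (hlast _ (Or.inr rfl)).2 (h.adj_getLast hRB hvP _ (List.getLast?_eq_some_getLast hP₀))
  have hvW : ∀ w ∈ W, B.Adj v w := fun w hw =>
    (hRB v w (hlast w (.inl hw)).1).resolve_left (hlast w (.inl hw)).2
  have main : ∀ A C, IsLongestPath B (A ++ v :: C) → (∀ a ∈ W, a ∉ A ++ v :: C) →
      2 * m ≤ A.length + C.length + 1 → 2 ≤ A.length → C ≠ [] → False := by
    intro A C h hW hlen hA hC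
    obtain ⟨p, M, x, rfl⟩ := List.exists_cons_append_singleton hA
    obtain ⟨l, hl, hll⟩ := h.exists_path_of_blue (m := m) hRB hW hWn hW₀ hWm (by simp at hlen; omega)
      (List.getLast?_eq_some_getLast hC) hvW
    exact (hR l hl).ne hll
  obtain ⟨A, C, rfl⟩ := List.append_of_mem hvP
  have hC : C ≠ [] := by
    rintro rfl
    exact (hlast _ (.inr rfl)).1 (by simp)
  have hA : A ≠ [] := by
    rintro rfl
    exact (hhead _ (.inr rfl)).1 (by simp)
  have hlen : 2 * m ≤ A.length + C.length + 1 := by simp at hP; omega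
  by_cases hA2 : 2 ≤ A.length
  · exact main A C h hW hlen hA2 hC
  · have hr : (A ++ v :: C).reverse = C.reverse ++ v :: A.reverse := by simp
    refine main C.reverse A.reverse (hr ▸ h.reverse) ?_ ?_ ?_ (by simpa using hA)
    · intro a ha
      rw [← hr, List.mem_reverse]
      exact hW a ha
    · simp only [List.length_reverse]; omega
    · simp only [List.length_reverse]; omega

end IsLongestPath

/-- In a two-coloured complete graph on `ℓ + m - 2` vertices with no red path on `2 * m` vertices
and no blue path on `ℓ > 2 * m` vertices, every vertex starts a red path on `m` vertices. -/
theorem exists_red_path_from {V : Type*} [Fintype V] {R B : SimpleGraph V} {m ℓ : ℕ}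
    (hRB : ∀ x y, x ≠ y → R.Adj x y ∨ B.Adj x y) (hm : 2 ≤ m) (hℓ : 2 * m < ℓ)
    (hcard : Fintype.card V = ℓ + m - 2) (hR : ∀ l, IsPathList R l → l.length < 2 * m)
    (hB : ∀ l, IsPathList B l → l.length < ℓ) (v : V) :
    ∃ l, IsPathList R (v :: l) ∧ m ≤ l.length + 1 := by
  obtain ⟨P, hP⟩ := exists_isLongestPath B
  obtain ⟨Q, hQ⟩ := exists_isLongestPath R
  have hPQ : 2 ≤ P.length ∨ 2 ≤ Q.length := by
    obtain ⟨x, y, hxy⟩ := Fintype.exists_pair_of_one_lt_card (α := V) (by omega)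
    rcases hRB x y hxy with h | h
    · exact .inr (hQ.2 [x, y] (by simp [IsPathList, h, hxy]))
    · exact .inl (hP.2 [x, y] (by simp [IsPathList, h, hxy]))
  have hQlt := hR Q hQ.1
  have hPlt := hB P hP.1
  have hle : Q.length ≤ P.length := by
    by_contra! hlt
    have := hQ.card_le (R := B) (fun x y h => (hRB x y h).symm) (by omega)
      fun l hl => (hP.2 l hl).trans hlt.le
    omega
  have := hP.card_le hRB (by omega) fun l hl => (hQ.2 l hl).trans hle
  obtain ⟨W, hWn, hWl, hW⟩ := hP.1.2.exists_nodup_disjoint (n := m - 1) (by omega)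
  exact hP.exists_path_from hRB hW hWn (by omega) hm (by omega) hR v

/-- for even k with 4 ≤ k < ℓ and r = ℓ + k/2 − 2, in every
(P_k, P_ℓ)-good coloring of two disjoint K_r's joined by an edge (u, v), that
edge is blue. -/
theorem stmt16 (k ℓ : ℕ) (hke : Even k) (hk : 4 ≤ k) (hkl : k < ℓ)
    (u v : Fin (ℓ + k / 2 - 2))
    (R : SimpleGraph (Fin (ℓ + k / 2 - 2) ⊕ Fin (ℓ + k / 2 - 2)))
    (hgood : GoodColoring (twoCliquesBridge (ℓ + k / 2 - 2) u v) R k ℓ) :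
    (twoCliquesBridge (ℓ + k / 2 - 2) u v \ R).Adj (Sum.inl u) (Sum.inr v) := by
  obtain ⟨-, hR, hB⟩ := hgood
  obtain ⟨m, rfl⟩ := hke.two_dvd
  have hm : 2 * m / 2 = m := by omega
  have hG : (twoCliquesBridge _ u v).Adj (Sum.inl u) (Sum.inr v) := by simp [twoCliquesBridge]
  refine SimpleGraph.sdiff_adj .. |>.2 ⟨hG, fun huv => ?_⟩
  have hRlt := fun l => IsPathList.length_lt (l := l) (by omega) hR
  have hBlt := fun l => IsPathList.length_lt (l := l) (by omega) hB
  have key : ∀ f : Fin (ℓ + 2 * m / 2 - 2) ↪ Fin (ℓ + 2 * m / 2 - 2) ⊕ Fin (ℓ + 2 * m / 2 - 2),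
      (∀ x y, x ≠ y → (twoCliquesBridge _ u v).Adj (f x) (f y)) →
      ∀ w, ∃ l, IsPathList R ((w :: l).map f) ∧ m ≤ l.length + 1 := by
    intro f hf w
    obtain ⟨l, hl, hlm⟩ := exists_red_path_from (R := R.comap f)
      (B := (twoCliquesBridge _ u v \ R).comap f) (m := m) (ℓ := ℓ)
      (fun x y hxy => by
        have := hf x y hxy
        simp only [SimpleGraph.comap_adj, SimpleGraph.sdiff_adj]
        tauto) (by omega) hkl (by simp [hm])
      (fun l hl => by simpa using hRlt _ (hl.map f)) (fun l hl => by simpa using hBlt _ (hl.map f)) w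
    exact ⟨l, hl.map f, hlm⟩
  obtain ⟨l₁, h₁, hm₁⟩ := key .inl (fun x y hxy => by simpa [twoCliquesBridge] using hxy) u
  obtain ⟨l₂, h₂, hm₂⟩ := key .inr (fun x y hxy => by simpa [twoCliquesBridge] using hxy) v
  have := hRlt (((u :: l₁).map Function.Embedding.inl).reverse ++
      (v :: l₂).map Function.Embedding.inr) <| by
    refine IsPathList.append_iff.2 ⟨h₁.reverse, h₂, ?_, ?_⟩
    · intro x hx hy
      simp only [List.mem_reverse, List.mem_map] at hx hy
      obtain ⟨a, -, rfl⟩ := hx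
      obtain ⟨b, -, hb⟩ := hy
      simp at hb
    · simpa using huv
  simp at this
  omega
end

section
/- For every integer ℓ ≥ 5, let G be the graph obtained from the complete graph K_{ℓ−1} by attaching a pendant vertex v (a new vertex adjacent to exactly one vertex of K_{ℓ−1}). Then G is (P_3, P_ℓ)-good, and in every (P_3, P_ℓ)-good coloring of G the pendant edge is colored red; consequently v is a strict endpoint of a red P_2 and is incident to no blue edge, so G is a (3, ℓ, 2)-red-transmitter. -/
/-- The complete graph on `Fin n` together with a pendant vertex (`none`) attached
to the vertex `a`. -/
def pendantComplete (n : ℕ) (a : Fin n) : SimpleGraph (Option (Fin n)) :=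
  SimpleGraph.fromRel (fun x y =>
    (∃ i j, x = some i ∧ y = some j) ∨ (x = none ∧ y = some a))

theorem eq_of_adj_of_not_hasNPath_three {V : Type*} {R : SimpleGraph V} (hR : ¬ HasNPath R 3)
    {x y z : V} (hy : R.Adj x y) (hz : R.Adj x z) : y = z := by
  by_contra hne
  refine hR ⟨y, z, .cons hy.symm (.cons hz .nil), ?_, by simp⟩
  simp [SimpleGraph.Walk.cons_isPath_iff, hy.ne', hz.ne, hne]

/-- If the non-edges of `H` within `S` lie in a graph of maximum degree at most one, then `H` has
a path through all of `S` starting at any prescribed vertex, provided `S` has at least four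
elements. -/
theorem exists_isPath_of_card_eq_add_four {V : Type*} [DecidableEq V] {H R : SimpleGraph V}
    (hR : ∀ x y z, R.Adj x y → R.Adj x z → y = z) (n : ℕ) (S : Finset V)
    (hS : S.card = n + 4) (hH : ∀ x ∈ S, ∀ y ∈ S, x ≠ y → ¬ R.Adj x y → H.Adj x y)
    (a : V) (ha : a ∈ S) :
    ∃ (w : V) (p : H.Walk a w), p.IsPath ∧ p.length = n + 3 ∧ ∀ x ∈ p.support, x ∈ S := by
  induction n generalizing S a with
  | zero =>
    have hcard : (S.erase a).card = 3 := by rw [Finset.card_erase_of_mem ha, hS]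
    obtain ⟨b, c, d, hbc, hbd, hcd, he⟩ := Finset.card_eq_three.mp hcard
    have hb : b ∈ S.erase a := by simp [he]
    have hc : c ∈ S.erase a := by simp [he]
    have hd : d ∈ S.erase a := by simp [he]
    rw [Finset.mem_erase] at hb hc hd
    have key : ∀ x y z, x ∈ S → y ∈ S → z ∈ S → a ≠ x → a ≠ y → a ≠ z → x ≠ y → x ≠ z → y ≠ z →
        ¬ R.Adj a x → ¬ R.Adj x y → ¬ R.Adj y z →
        ∃ (w : V) (p : H.Walk a w), p.IsPath ∧ p.length = 0 + 3 ∧ ∀ x ∈ p.support, x ∈ S := by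
      intro x y z hx hy hz hax hay haz hxy hxz hyz h1 h2 h3
      refine ⟨z, .cons (hH a ha x hx hax h1) (.cons (hH x hx y hy hxy h2)
        (.cons (hH y hy z hz hyz h3) .nil)), ?_, by simp, ?_⟩
      · simp [SimpleGraph.Walk.cons_isPath_iff, *]
      · simp [*]
    have hsymm : ∀ x y, R.Adj x y → R.Adj y x := fun _ _ h => h.symm
    by_cases hab : R.Adj a b
    · exact key c b d hc.2 hb.2 hd.2 (by grind) (by grind) (by grind) (by grind) (by grind)
        (by grind) (by grind) (by grind) (by grind)
    by_cases hac : R.Adj a c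
    · exact key b c d hb.2 hc.2 hd.2 (by grind) (by grind) (by grind) (by grind) (by grind)
        (by grind) (by grind) (by grind) (by grind)
    by_cases hrbc : R.Adj b c
    · exact key b d c hb.2 hd.2 hc.2 (by grind) (by grind) (by grind) (by grind) (by grind)
        (by grind) (by grind) (by grind) (by grind)
    by_cases hrcd : R.Adj c d
    · exact key c b d hc.2 hb.2 hd.2 (by grind) (by grind) (by grind) (by grind) (by grind)
        (by grind) (by grind) (by grind) (by grind)
    · exact key b c d hb.2 hc.2 hd.2 (by grind) (by grind) (by grind) (by grind) (by grind)
        (by grind) (by grind) (by grind) (by grind)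
  | succ n ih =>
    have hcard : (S.erase a).card = n + 4 := by rw [Finset.card_erase_of_mem ha, hS]; rfl
    obtain ⟨b, hb, hab⟩ : ∃ b ∈ S.erase a, ¬ R.Adj a b := by
      obtain ⟨x, hx, y, hy, hxy⟩ := Finset.one_lt_card.mp (by omega : 1 < (S.erase a).card)
      by_cases hax : R.Adj a x
      · exact ⟨y, hy, fun hay => hxy (hR a x y hax hay)⟩
      · exact ⟨x, hx, hax⟩
    obtain ⟨w, p, hp, hlen, hsup⟩ := ih (S.erase a) hcard
      (fun x hx y hy => hH x (Finset.mem_of_mem_erase hx) y (Finset.mem_of_mem_erase hy)) b hb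
    rw [Finset.mem_erase] at hb
    refine ⟨w, .cons (hH a ha b hb.2 hb.1.symm hab) p, ?_, by simp [hlen], ?_⟩
    · rw [SimpleGraph.Walk.cons_isPath_iff]
      exact ⟨hp, fun h => Finset.notMem_erase a S (hsup a h)⟩
    · intro x hx
      rw [SimpleGraph.Walk.support_cons, List.mem_cons] at hx
      rcases hx with rfl | hx
      · exact ha
      · exact Finset.mem_of_mem_erase (hsup x hx)

theorem pendantComplete_adj_none {n : ℕ} {a : Fin n} {u : Option (Fin n)} :
    (pendantComplete n a).Adj none u ↔ u = some a := by
  simp [pendantComplete, SimpleGraph.fromRel_adj]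
  rintro rfl
  simp

theorem pendantComplete_adj_some {n : ℕ} {a i j : Fin n} :
    (pendantComplete n a).Adj (some i) (some j) ↔ i ≠ j := by
  simp [pendantComplete, SimpleGraph.fromRel_adj]

theorem isGood_pendantComplete (n : ℕ) (hn : 1 ≤ n) (a : Fin n) :
    IsGood (pendantComplete n a) 3 (n + 1) := by
  refine ⟨SimpleGraph.edge none (some a), ?_, ?_, ?_⟩
  · rw [SimpleGraph.edge_le_iff]
    exact Or.inr (pendantComplete_adj_none.mpr rfl)
  · rintro ⟨u, w, p, hp, hlen⟩
    match p, hp, hlen with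
    | .cons h (.cons h' .nil), hp, _ =>
      simp only [SimpleGraph.edge_adj] at h h'
      simp [SimpleGraph.Walk.cons_isPath_iff] at hp
      grind
  · rintro ⟨u, w, p, hp, hlen⟩
    have hham : p.IsHamiltonian :=
      SimpleGraph.Walk.isHamiltonian_iff_isPath_and_length_eq.mpr ⟨hp, by simp; omega⟩
    have hmem : none ∈ p.support := hham.mem_support none
    have hiso : ∀ x, ¬ (pendantComplete n a \ SimpleGraph.edge none (some a)).Adj none x := by
      intro x hx
      rw [SimpleGraph.sdiff_adj, pendantComplete_adj_none, SimpleGraph.edge_adj] at hx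
      grind
    have hnil : ¬ p.Nil := by
      rw [← SimpleGraph.Walk.length_eq_zero_iff]
      omega
    obtain ⟨x, hx⟩ := SimpleGraph.mem_support_of_mem_walk_support p hnil hmem
    exact hiso x hx

/-- for ℓ ≥ 5, K_{ℓ−1} with a pendant vertex v is (P_3, P_ℓ)-good, and
in every (P_3, P_ℓ)-good coloring the pendant edge is red; consequently v is a strict
endpoint of a red P_2 and is incident to no blue edge (a (3, ℓ, 2)-red-transmitter). -/
theorem stmt17 (ℓ : ℕ) (hℓ : 5 ≤ ℓ) (a : Fin (ℓ - 1)) :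
    IsGood (pendantComplete (ℓ - 1) a) 3 ℓ ∧
    ∀ R : SimpleGraph (Option (Fin (ℓ - 1))),
      GoodColoring (pendantComplete (ℓ - 1) a) R 3 ℓ →
        R.Adj none (some a) ∧ StrictEndpoint R none 2 ∧
        ∀ u, ¬ (pendantComplete (ℓ - 1) a \ R).Adj none u := by
  obtain ⟨m, rfl⟩ : ∃ m, ℓ = m + 5 := ⟨ℓ - 5, by omega⟩
  refine ⟨isGood_pendantComplete (m + 4) (by omega) a, ?_⟩
  rintro R ⟨hle, hred, hblue⟩
  have hR : ∀ x y z, R.Adj x y → R.Adj x z → y = z :=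
    fun _ _ _ => eq_of_adj_of_not_hasNPath_three hred
  have hadj : R.Adj none (some a) := by
    by_contra hna
    obtain ⟨w, p, hp, hlen, hsup⟩ := exists_isPath_of_card_eq_add_four
      (H := pendantComplete (m + 4) a \ R) hR m (Finset.univ.map Function.Embedding.some)
      (by simp) (by
        simp only [Finset.mem_map, Finset.mem_univ, true_and, Function.Embedding.some_apply]
        rintro _ ⟨i, rfl⟩ _ ⟨j, rfl⟩ hij hn
        exact ⟨pendantComplete_adj_some.mpr fun h => hij (congrArg some h), hn⟩)
      (some a) (by simp)
    refine hblue ⟨none, w, .cons ⟨pendantComplete_adj_none.mpr rfl, hna⟩ p, ?_, by simp [hlen]⟩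
    rw [SimpleGraph.Walk.cons_isPath_iff]
    exact ⟨hp, fun h => by simpa using hsup none h⟩
  refine ⟨hadj, ⟨⟨some a, .cons hadj .nil, by simp, by simp⟩, ?_⟩, ?_⟩
  · rintro y ⟨w, p, hp, rfl⟩
    match p, hp with
    | .nil, _ => simp
    | .cons _ .nil, _ => simp
    | .cons h (.cons h' q), hp =>
      have := hR _ _ _ h.symm h'
      subst this
      simp [SimpleGraph.Walk.cons_isPath_iff] at hp
  · intro u hu
    rw [SimpleGraph.sdiff_adj, pendantComplete_adj_none] at hu
    obtain ⟨rfl, hu⟩ := hu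
    exact hu hadj
end
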